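/- Let Θ be the standard simplex in ℝ^k, let f : Θ → ℝ be a nonnegative bounded continuous function attaining its supremum f_max at a unique point θ₀ ∈ Θ, and for δ > 0 set Θ_δ = {θ ∈ Θ : f(θ) ≥ f_max − δ}. Let L : Θ → ℝ be a nonnegative bounded measurable function that is continuous on some neighborhood of θ₀ (relative to Θ) and satisfies L(θ₀) > 0. Then lim_{δ→0} inf_{θ∈Θ_δ} L(θ) exists and is strictly positive. -/

import Mathlib

open MeasureTheory Filter Topology

/-- In a compact space, the superlevel sets of a continuous function with a unique maximizer
shrink to the maximizer. -/
theorem eventually_superlevel_subset {X : Type*} [TopologicalSpace X] [CompactSpace X]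
    {f : X → ℝ} (hf : Continuous f) {x₀ : X} (hlt : ∀ x, x ≠ x₀ → f x < f x₀)
    {U : Set X} (hU : U ∈ 𝓝 x₀) :
    ∀ᶠ δ in 𝓝[>] (0 : ℝ), {x | f x₀ - δ ≤ f x} ⊆ U := by
  obtain ⟨V, hVU, hVo, hxV⟩ := mem_nhds_iff.1 hU
  rcases (Vᶜ).eq_empty_or_nonempty with hV | hV
  · refine Eventually.of_forall fun δ x _ => hVU ?_
    rw [Set.compl_empty_iff.1 hV]
    trivial
  · obtain ⟨y, hyV, hy⟩ := hVo.isClosed_compl.isCompact.exists_isMaxOn hV hf.continuousOn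
    have hyx : f y < f x₀ := hlt y fun h => hyV (h ▸ hxV)
    filter_upwards [Ioo_mem_nhdsGT (sub_pos.2 hyx)] with δ hδ x hx
    by_contra hxU
    have h₁ : f x ≤ f y := hy fun h => hxU (hVU h)
    have h₂ : f x₀ - δ ≤ f x := hx
    linarith [hδ.2]

/-- The infimum of a function bounded below over the superlevel sets of a continuous function with
a unique maximizer tends to its value there, if it is continuous at the maximizer. -/
theorem tendsto_sInf_image_superlevel {X : Type*} [TopologicalSpace X] [CompactSpace X]
    {f : X → ℝ} (hf : Continuous f) {x₀ : X} (hlt : ∀ x, x ≠ x₀ → f x < f x₀)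
    {L : X → ℝ} (hL : BddBelow (Set.range L)) (hL_cont : ContinuousAt L x₀) :
    Tendsto (fun δ => sInf (L '' {x | f x₀ - δ ≤ f x})) (𝓝[>] (0 : ℝ)) (𝓝 (L x₀)) := by
  have hmem : ∀ δ : ℝ, 0 < δ → L x₀ ∈ L '' {x | f x₀ - δ ≤ f x} := fun δ hδ =>
    ⟨x₀, sub_le_self _ hδ.le, rfl⟩
  refine tendsto_order.2 ⟨fun a ha => ?_, fun b hb => ?_⟩
  · obtain ⟨a', haa', ha'⟩ := exists_between ha
    filter_upwards [eventually_superlevel_subset hf hlt (hL_cont.eventually (lt_mem_nhds ha')),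
      self_mem_nhdsWithin] with δ hδ hδ₀
    refine haa'.trans_le (le_csInf ⟨_, hmem δ hδ₀⟩ ?_)
    rintro _ ⟨x, hx, rfl⟩
    exact (hδ hx).le
  · filter_upwards [self_mem_nhdsWithin] with δ hδ₀
    exact (csInf_le (hL.mono (Set.image_subset_range _ _)) (hmem δ hδ₀)).trans_lt hb

/-- **Remark 1 (technical preliminaries).**
Let `Θ` be the standard simplex in `ℝ^k`, let `f : Θ → ℝ` be a nonnegative bounded
continuous function attaining its supremum `fmax` at a unique point `θ₀`, and for
`δ > 0` let `Θ_δ = {θ ∈ Θ | f θ ≥ fmax - δ}`.  If `L : Θ → ℝ` is a nonnegative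
bounded measurable function, continuous on some neighborhood of `θ₀` (relative to
`Θ`) with `L θ₀ > 0`, then `lim_{δ→0⁺} inf_{θ ∈ Θ_δ} L θ` exists and is strictly
positive. -/
theorem liminf_positive_of_unique_max
    (k : ℕ)
    (f : stdSimplex ℝ (Fin k) → ℝ)
    (hf_nonneg : ∀ θ, 0 ≤ f θ)
    (hf_cont : Continuous f)
    (fmax : ℝ)
    (θ₀ : stdSimplex ℝ (Fin k))
    (hθ₀ : f θ₀ = fmax)
    (hmax : ∀ θ, f θ ≤ fmax)
    (huniq : ∀ θ, f θ = fmax → θ = θ₀)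
    (L : stdSimplex ℝ (Fin k) → ℝ)
    (hL_nonneg : ∀ θ, 0 ≤ L θ)
    (hL_bdd : ∃ C, ∀ θ, L θ ≤ C)
    (hL_meas : Measurable L)
    (hL_cont : ∃ U ∈ 𝓝 θ₀, ContinuousOn L U)
    (hL_pos : 0 < L θ₀) :
    ∃ c > 0,
      Tendsto (fun δ => sInf (L '' {θ | fmax - δ ≤ f θ})) (𝓝[>] (0 : ℝ)) (𝓝 c) := by
  obtain ⟨U, hU, hLU⟩ := hL_cont
  subst hθ₀
  refine ⟨L θ₀, hL_pos, tendsto_sInf_image_superlevel hf_cont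
    (fun θ hθ => (hmax θ).lt_of_ne fun h => hθ (huniq θ h)) ⟨0, ?_⟩ (hLU.continuousAt hU)⟩
  rintro _ ⟨θ, rfl⟩
  exact hL_nonneg θ
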